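/- Assume there are t_max ∈ ℕ with t_max ≥ 1 and ρ ∈ (0,1) such that E[τ|cog,a] ≤ t_max and E[γ^τ|cog,a] ≤ ρ for every cog ∈ C and a ∈ A(cog). Then for every horizon n ≥ 0, every cog ∈ C, every q ∈ ℤ and every Δ ∈ ℕ: V_n(q,cog) − V_n(q+Δ,cog) ≤ ( c·t_max·(1−ρⁿ)/(1−ρ) + C₀·ρⁿ )·Δ. -/

import Mathlib

open scoped BigOperators

namespace Fidelity

/-- The actions available to the human operator: skip, rest, normal fidelity, high fidelity. -/
inductive Action : Type
  | S | R | N | H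
deriving DecidableEq

/-- Admissible action set: `{S, N, H}` for `cog ≤ cog*` and `{S, R, N, H}` for `cog > cog*`. -/
def Act {C : Type*} [LinearOrder C] (cogStar cog : C) : Finset Action :=
  if cog ≤ cogStar then {Action.S, Action.N, Action.H}
  else {Action.S, Action.R, Action.N, Action.H}

lemma Act_nonempty {C : Type*} [LinearOrder C] (cogStar cog : C) :
    (Act cogStar cog).Nonempty := by
  unfold Act; split <;> exact ⟨Action.S, by simp⟩

/-- The reward `r(a)`: `r(H) = r_H`, `r(N) = r_N`, `r(S) = r(R) = 0`. -/
noncomputable def rew (rH rN : ℝ) : Action → ℝ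
  | Action.H => rH
  | Action.N => rN
  | _ => 0

/-- Expected net immediate reward
`R((q,cog),a) = r(a) − c·E[τ|cog,a]·q − (cλ/2)·E[τ²|cog,a]`. -/
noncomputable def Rimm {C : Type*} (c lam rH rN : ℝ) (Etau Etau2 : C → Action → ℝ)
    (q : ℤ) (cog : C) (a : Action) : ℝ :=
  rew rH rN a - c * Etau cog a * (q : ℝ) - c * lam / 2 * Etau2 cog a

/-- The Poisson probability of `w` arrivals when the mean number of arrivals is `μ`. -/
noncomputable def poissonPMF (μ : ℝ) (w : ℕ) : ℝ :=
  Real.exp (-μ) * μ ^ w / (w.factorial : ℝ)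

/-- The next queue length: `q − 1 + w` under actions `S, N, H` and `q + w` under `R`. -/
def nextQ (a : Action) (q : ℤ) (w : ℕ) : ℤ :=
  if a = Action.R then q + (w : ℤ) else q - 1 + (w : ℤ)

/-- `E[γ^τ | cog, a]`, the expected discount over a sojourn in state `cog` under action `a`. -/
noncomputable def Egamma {C : Type*} [Fintype C] (γ : ℝ) (P : C → Action → ℕ → C → ℝ)
    (cog : C) (a : Action) : ℝ :=
  ∑' (τ : ℕ), ∑' (cog' : C), γ ^ τ * P cog a τ cog'

/-- The Q-value of action `a` at `(q, cog)` for the continuation value function `V`: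
`Q_V(q,cog,a) = R((q,cog),a) + Σ_{τ,cog',w} γ^τ·P(τ,cog'|cog,a)·Poisson(λτ)(w)·V(q',cog')`. -/
noncomputable def Qval {C : Type*} [Fintype C] (c lam rH rN γ : ℝ)
    (Etau Etau2 : C → Action → ℝ) (P : C → Action → ℕ → C → ℝ)
    (V : ℤ → C → ℝ) (q : ℤ) (cog : C) (a : Action) : ℝ :=
  Rimm c lam rH rN Etau Etau2 q cog a +
    ∑' (τ : ℕ), ∑' (cog' : C), ∑' (w : ℕ),
      γ ^ τ * P cog a τ cog' * poissonPMF (lam * (τ : ℝ)) w * V (nextQ a q w) cog'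

/-- The `n`-step optimal value functions: `V_0(q,cog) = −C₀·q` and
`V_{n+1}(q,cog) = max_{a ∈ A(cog)} Q_{V_n}(q,cog,a)`. -/
noncomputable def Vn {C : Type*} [LinearOrder C] [Fintype C] (cogStar : C)
    (c lam rH rN γ C0 : ℝ) (Etau Etau2 : C → Action → ℝ)
    (P : C → Action → ℕ → C → ℝ) : ℕ → ℤ → C → ℝ
  | 0, q, _ => -C0 * (q : ℝ)
  | n + 1, q, cog =>
      (Act cogStar cog).sup' (Act_nonempty cogStar cog) fun a =>
        Qval c lam rH rN γ Etau Etau2 P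
          (Vn cogStar c lam rH rN γ C0 Etau Etau2 P n) q cog a

lemma poissonPMF_nonneg {μ : ℝ} (hμ : 0 ≤ μ) (w : ℕ) : 0 ≤ poissonPMF μ w := by
  unfold poissonPMF; positivity

lemma hasSum_poissonPMF (μ : ℝ) : HasSum (poissonPMF μ) 1 := by
  convert! (NormedSpace.expSeries_div_hasSum_exp μ).mul_left (Real.exp (-μ)) using 1
  · funext w
    simp only [poissonPMF, mul_div_assoc]
  · rw [← Real.exp_eq_exp_ℝ, ← Real.exp_add, neg_add_cancel, Real.exp_zero]

lemma hasSum_natCast_mul_poissonPMF (μ : ℝ) :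
    HasSum (fun w : ℕ => (w : ℝ) * poissonPMF μ w) μ := by
  rw [← hasSum_nat_add_iff' 1]
  simp only [Finset.range_one, Finset.sum_singleton, Nat.cast_zero, zero_mul, sub_zero]
  convert! (hasSum_poissonPMF μ).mul_left μ using 1
  · funext w
    have : ((w : ℝ) + 1) ≠ 0 := by positivity
    have : (w.factorial : ℝ) ≠ 0 := by positivity
    simp only [poissonPMF, Nat.factorial_succ, Nat.cast_mul, Nat.cast_add, Nat.cast_one]
    field_simp
    ring
  · rw [mul_one]

lemma abs_nextQ_le (a : Action) (q : ℤ) (w : ℕ) :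
    |(nextQ a q w : ℝ)| ≤ 1 + |(q : ℝ)| + w := by
  unfold nextQ
  split <;> push_cast <;> rw [abs_le] <;> constructor <;>
    linarith [neg_abs_le (q : ℝ), le_abs_self (q : ℝ), Nat.cast_nonneg (α := ℝ) w]

lemma nextQ_add (a : Action) (q d : ℤ) (w : ℕ) : nextQ a (q + d) w = nextQ a q w + d := by
  unfold nextQ; split <;> ring

/-- A function of the queue length dominated by a multiple of `1 + |q|`. -/
def LinearGrowth (f : ℤ → ℝ) : Prop := ∃ A : ℝ, ∀ q : ℤ, |f q| ≤ A * (1 + |(q : ℝ)|)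

lemma LinearGrowth.exists_uniform {ι : Type*} (s : Finset ι) {f : ι → ℤ → ℝ}
    (hf : ∀ i ∈ s, LinearGrowth (f i)) :
    ∃ A : ℝ, 0 ≤ A ∧ ∀ i ∈ s, ∀ q : ℤ, |f i q| ≤ A * (1 + |(q : ℝ)|) := by
  choose! A hA using hf
  obtain ⟨M, hM⟩ := (s.image A).exists_le
  refine ⟨max M 0, le_max_right _ _, fun i hi q => (hA i hi q).trans ?_⟩
  have := (hM _ (Finset.mem_image_of_mem A hi)).trans (le_max_left M 0)
  gcongr

lemma LinearGrowth.sup' {ι : Type*} {s : Finset ι} (hs : s.Nonempty) {f : ι → ℤ → ℝ}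
    (hf : ∀ i ∈ s, LinearGrowth (f i)) : LinearGrowth fun q => s.sup' hs fun i => f i q := by
  obtain ⟨A, -, hA⟩ := LinearGrowth.exists_uniform s hf
  refine ⟨A, fun q => ?_⟩
  obtain ⟨i, hi, h⟩ := s.exists_mem_eq_sup' hs fun i => f i q
  beta_reduce
  rw [h]
  exact hA i hi q

section Arrivals

variable {k μ A : ℝ} {f : ℤ → ℝ}

lemma abs_poisson_term_le (hk : 0 ≤ k) (hμ : 0 ≤ μ) (hA : 0 ≤ A)
    (hf : ∀ q : ℤ, |f q| ≤ A * (1 + |(q : ℝ)|)) (a : Action) (q : ℤ) (w : ℕ) :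
    ‖k * poissonPMF μ w * f (nextQ a q w)‖ ≤
      k * A * ((2 + |(q : ℝ)|) * poissonPMF μ w + w * poissonPMF μ w) := by
  have hp := poissonPMF_nonneg hμ w
  have h : |f (nextQ a q w)| ≤ A * (2 + |(q : ℝ)| + w) :=
    (hf _).trans (mul_le_mul_of_nonneg_left (by linarith [abs_nextQ_le a q w]) hA)
  rw [Real.norm_eq_abs, abs_mul, abs_of_nonneg (mul_nonneg hk hp)]
  calc k * poissonPMF μ w * |f (nextQ a q w)|
      ≤ k * poissonPMF μ w * (A * (2 + |(q : ℝ)| + w)) := by gcongr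
    _ = _ := by ring

lemma hasSum_poisson_bound (k μ A : ℝ) (q : ℤ) :
    HasSum (fun w : ℕ => k * A * ((2 + |(q : ℝ)|) * poissonPMF μ w + w * poissonPMF μ w))
      (k * (A * (2 + |(q : ℝ)| + μ))) := by
  convert! (((hasSum_poissonPMF μ).mul_left (2 + |(q : ℝ)|)).add
    (hasSum_natCast_mul_poissonPMF μ)).mul_left (k * A) using 1
  ring

lemma summable_poisson_term (hk : 0 ≤ k) (hμ : 0 ≤ μ) (hA : 0 ≤ A)
    (hf : ∀ q : ℤ, |f q| ≤ A * (1 + |(q : ℝ)|)) (a : Action) (q : ℤ) :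
    Summable fun w : ℕ => k * poissonPMF μ w * f (nextQ a q w) :=
  Summable.of_norm_bounded (hasSum_poisson_bound k μ A q).summable
    (abs_poisson_term_le hk hμ hA hf a q)

lemma abs_tsum_poisson_le (hk : 0 ≤ k) (hμ : 0 ≤ μ) (hA : 0 ≤ A)
    (hf : ∀ q : ℤ, |f q| ≤ A * (1 + |(q : ℝ)|)) (a : Action) (q : ℤ) :
    |∑' w : ℕ, k * poissonPMF μ w * f (nextQ a q w)| ≤ k * (A * (2 + |(q : ℝ)| + μ)) :=
  tsum_of_norm_bounded (hasSum_poisson_bound k μ A q) (abs_poisson_term_le hk hμ hA hf a q)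

lemma tsum_poisson_sub_le (hk : 0 ≤ k) (hμ : 0 ≤ μ) (hA : 0 ≤ A)
    (hf : ∀ q : ℤ, |f q| ≤ A * (1 + |(q : ℝ)|)) {d : ℤ} {D : ℝ}
    (hD : ∀ q, f q - f (q + d) ≤ D) (a : Action) (q : ℤ) :
    (∑' w : ℕ, k * poissonPMF μ w * f (nextQ a q w)) -
      ∑' w : ℕ, k * poissonPMF μ w * f (nextQ a (q + d) w) ≤ k * D := by
  have h₁ := summable_poisson_term hk hμ hA hf a q
  have h₂ := summable_poisson_term hk hμ hA hf a (q + d)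
  have h₃ : HasSum (fun w : ℕ => k * D * poissonPMF μ w) (k * D) := by
    simpa using (hasSum_poissonPMF μ).mul_left (k * D)
  rw [← h₁.tsum_sub h₂]
  refine hasSum_le (fun w => ?_) (h₁.sub h₂).hasSum h₃
  have hp := mul_nonneg hk (poissonPMF_nonneg hμ w)
  rw [nextQ_add, ← mul_sub]
  calc _ ≤ k * poissonPMF μ w * D := mul_le_mul_of_nonneg_left (hD _) hp
    _ = _ := by ring

end Arrivals

section Continuation

variable {C : Type*} [Fintype C] {lam γ A : ℝ} {p : ℕ → C → ℝ} {V : ℤ → C → ℝ}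

lemma abs_sum_continuation_le (hlam : 0 ≤ lam) (hγ0 : 0 ≤ γ) (hγ1 : γ ≤ 1)
    (hp : ∀ τ x, 0 ≤ p τ x) (hp0 : ∀ x, p 0 x = 0) (hA : 0 ≤ A)
    (hV : ∀ x, ∀ q : ℤ, |V q x| ≤ A * (1 + |(q : ℝ)|)) (a : Action) (q : ℤ) (τ : ℕ) :
    |∑' x : C, ∑' w : ℕ, γ ^ τ * p τ x * poissonPMF (lam * (τ : ℝ)) w * V (nextQ a q w) x| ≤
      A * (2 + lam) * (1 + |(q : ℝ)|) * ((τ : ℝ) ^ 2 * ∑' x : C, p τ x) := by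
  rw [tsum_fintype, tsum_fintype, Finset.mul_sum, Finset.mul_sum]
  refine (Finset.abs_sum_le_sum_abs _ _).trans (Finset.sum_le_sum fun x _ => ?_)
  rcases Nat.eq_zero_or_pos τ with rfl | hτ
  · simp [hp0]
  have hτ' : (1 : ℝ) ≤ τ := by exact_mod_cast hτ
  have hτ2 : (1 : ℝ) ≤ (τ : ℝ) ^ 2 := by nlinarith
  have hpx := hp τ x
  have hq := abs_nonneg (q : ℝ)
  refine (abs_tsum_poisson_le (f := fun q => V q x) (by positivity) (by positivity) hA (hV x)
    a q).trans ?_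
  have h₁ : γ ^ τ * p τ x ≤ p τ x := mul_le_of_le_one_left hpx (pow_le_one₀ hγ0 hγ1)
  have h₂ : 2 + |(q : ℝ)| + lam * τ ≤ (2 + lam) * (1 + |(q : ℝ)|) * (τ : ℝ) ^ 2 := by
    have h₃ : lam * (τ : ℝ) ≤ lam * (1 + |(q : ℝ)|) * (τ : ℝ) ^ 2 := by
      rw [mul_assoc]
      exact mul_le_mul_of_nonneg_left (by nlinarith) hlam
    nlinarith
  calc γ ^ τ * p τ x * (A * (2 + |(q : ℝ)| + lam * τ))
      ≤ p τ x * (A * ((2 + lam) * (1 + |(q : ℝ)|) * (τ : ℝ) ^ 2)) := by gcongr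
    _ = _ := by ring

lemma summable_continuation (hlam : 0 ≤ lam) (hγ0 : 0 ≤ γ) (hγ1 : γ ≤ 1)
    (hp : ∀ τ x, 0 ≤ p τ x) (hp0 : ∀ x, p 0 x = 0)
    (hp2 : Summable fun τ : ℕ => (τ : ℝ) ^ 2 * ∑' x : C, p τ x) (hA : 0 ≤ A)
    (hV : ∀ x, ∀ q : ℤ, |V q x| ≤ A * (1 + |(q : ℝ)|)) (a : Action) (q : ℤ) :
    Summable fun τ : ℕ => ∑' x : C, ∑' w : ℕ,
      γ ^ τ * p τ x * poissonPMF (lam * (τ : ℝ)) w * V (nextQ a q w) x :=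
  Summable.of_norm_bounded (hp2.mul_left _)
    (abs_sum_continuation_le hlam hγ0 hγ1 hp hp0 hA hV a q)

lemma abs_tsum_continuation_le (hlam : 0 ≤ lam) (hγ0 : 0 ≤ γ) (hγ1 : γ ≤ 1)
    (hp : ∀ τ x, 0 ≤ p τ x) (hp0 : ∀ x, p 0 x = 0)
    (hp2 : Summable fun τ : ℕ => (τ : ℝ) ^ 2 * ∑' x : C, p τ x) (hA : 0 ≤ A)
    (hV : ∀ x, ∀ q : ℤ, |V q x| ≤ A * (1 + |(q : ℝ)|)) (a : Action) (q : ℤ) :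
    |∑' τ : ℕ, ∑' x : C, ∑' w : ℕ,
      γ ^ τ * p τ x * poissonPMF (lam * (τ : ℝ)) w * V (nextQ a q w) x| ≤
      A * (2 + lam) * (1 + |(q : ℝ)|) * ∑' τ : ℕ, (τ : ℝ) ^ 2 * ∑' x : C, p τ x :=
  (Real.norm_eq_abs _).symm.trans_le <| tsum_of_norm_bounded (hp2.hasSum.mul_left _)
    (abs_sum_continuation_le hlam hγ0 hγ1 hp hp0 hA hV a q)

lemma summable_discount (hγ0 : 0 ≤ γ) (hγ1 : γ ≤ 1)
    (hp : ∀ τ x, 0 ≤ p τ x) (hp0 : ∀ x, p 0 x = 0)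
    (hp2 : Summable fun τ : ℕ => (τ : ℝ) ^ 2 * ∑' x : C, p τ x) :
    Summable fun τ : ℕ => ∑' x : C, γ ^ τ * p τ x := by
  refine Summable.of_nonneg_of_le (fun τ => tsum_nonneg fun x => mul_nonneg (by positivity)
    (hp τ x)) (fun τ => ?_) hp2
  rw [tsum_mul_left]
  rcases Nat.eq_zero_or_pos τ with rfl | hτ
  · simp [hp0]
  have hτ' : (1 : ℝ) ≤ τ := by exact_mod_cast hτ
  exact mul_le_mul_of_nonneg_right ((pow_le_one₀ hγ0 hγ1).trans (one_le_pow₀ hτ'))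
    (tsum_nonneg (hp τ))

lemma tsum_continuation_sub_le (hlam : 0 ≤ lam) (hγ0 : 0 ≤ γ) (hγ1 : γ ≤ 1)
    (hp : ∀ τ x, 0 ≤ p τ x) (hp0 : ∀ x, p 0 x = 0)
    (hp2 : Summable fun τ : ℕ => (τ : ℝ) ^ 2 * ∑' x : C, p τ x) (hA : 0 ≤ A)
    (hV : ∀ x, ∀ q : ℤ, |V q x| ≤ A * (1 + |(q : ℝ)|)) {d : ℤ} {D : ℝ}
    (hD : ∀ x q, V q x - V (q + d) x ≤ D) (a : Action) (q : ℤ) :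
    (∑' τ : ℕ, ∑' x : C, ∑' w : ℕ,
        γ ^ τ * p τ x * poissonPMF (lam * (τ : ℝ)) w * V (nextQ a q w) x) -
      (∑' τ : ℕ, ∑' x : C, ∑' w : ℕ,
        γ ^ τ * p τ x * poissonPMF (lam * (τ : ℝ)) w * V (nextQ a (q + d) w) x) ≤
      (∑' τ : ℕ, ∑' x : C, γ ^ τ * p τ x) * D := by
  have h₁ := summable_continuation hlam hγ0 hγ1 hp hp0 hp2 hA hV a q
  have h₂ := summable_continuation hlam hγ0 hγ1 hp hp0 hp2 hA hV a (q + d)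
  rw [← h₁.tsum_sub h₂]
  refine hasSum_le (fun τ => ?_) (h₁.sub h₂).hasSum
    ((summable_discount hγ0 hγ1 hp hp0 hp2).hasSum.mul_right D)
  simp only [tsum_fintype, ← Finset.sum_sub_distrib, Finset.sum_mul]
  exact Finset.sum_le_sum fun x _ =>
    tsum_poisson_sub_le (f := fun q => V q x) (mul_nonneg (by positivity) (hp τ x))
      (by positivity) hA (hV x) (hD x) a q

end Continuation

section Bellman

variable {C : Type*} [Fintype C] {c lam rH rN γ : ℝ} {Etau Etau2 : C → Action → ℝ}
  {P : C → Action → ℕ → C → ℝ} {V : ℤ → C → ℝ}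

lemma linearGrowth_Qval (hlam : 0 ≤ lam) (hγ0 : 0 ≤ γ) (hγ1 : γ ≤ 1)
    (hPnn : ∀ cog a τ cog', 0 ≤ P cog a τ cog') (hP0 : ∀ cog a cog', P cog a 0 cog' = 0)
    (hMom2 : ∀ cog a, Summable fun τ : ℕ => (τ : ℝ) ^ 2 * ∑' (cog' : C), P cog a τ cog')
    (hV : ∀ x, LinearGrowth fun q => V q x) (cog : C) (a : Action) :
    LinearGrowth fun q => Qval c lam rH rN γ Etau Etau2 P V q cog a := by
  obtain ⟨A, hA, hVA⟩ := LinearGrowth.exists_uniform Finset.univ fun x _ => hV x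
  have hcont := abs_tsum_continuation_le hlam hγ0 hγ1 (hPnn cog a) (hP0 cog a) (hMom2 cog a) hA
    (fun x => hVA x (Finset.mem_univ x)) a
  refine ⟨|rew rH rN a - c * lam / 2 * Etau2 cog a| + |c * Etau cog a| +
    A * (2 + lam) * ∑' τ : ℕ, (τ : ℝ) ^ 2 * ∑' x : C, P cog a τ x, fun q => ?_⟩
  have hR : |Rimm c lam rH rN Etau Etau2 q cog a| ≤
      |rew rH rN a - c * lam / 2 * Etau2 cog a| + |c * Etau cog a| * |(q : ℝ)| := by
    rw [← abs_mul]
    convert! abs_sub (rew rH rN a - c * lam / 2 * Etau2 cog a) (c * Etau cog a * (q : ℝ)) using 2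
    unfold Rimm
    ring
  refine (abs_add_le _ _).trans ((add_le_add hR (hcont q)).trans ?_)
  nlinarith [mul_nonneg (abs_nonneg (rew rH rN a - c * lam / 2 * Etau2 cog a))
    (abs_nonneg (q : ℝ)), abs_nonneg (c * Etau cog a)]

lemma Qval_sub_le (hlam : 0 ≤ lam) (hγ0 : 0 ≤ γ) (hγ1 : γ ≤ 1)
    (hPnn : ∀ cog a τ cog', 0 ≤ P cog a τ cog') (hP0 : ∀ cog a cog', P cog a 0 cog' = 0)
    (hMom2 : ∀ cog a, Summable fun τ : ℕ => (τ : ℝ) ^ 2 * ∑' (cog' : C), P cog a τ cog')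
    (hV : ∀ x, LinearGrowth fun q => V q x) {d : ℤ} {D : ℝ}
    (hD : ∀ x q, V q x - V (q + d) x ≤ D) (cog : C) (a : Action) (q : ℤ) :
    Qval c lam rH rN γ Etau Etau2 P V q cog a - Qval c lam rH rN γ Etau Etau2 P V (q + d) cog a ≤
      c * Etau cog a * d + Egamma γ P cog a * D := by
  obtain ⟨A, hA, hVA⟩ := LinearGrowth.exists_uniform Finset.univ fun x _ => hV x
  have h := tsum_continuation_sub_le hlam hγ0 hγ1 (hPnn cog a) (hP0 cog a) (hMom2 cog a) hA
    (fun x => hVA x (Finset.mem_univ x)) hD a q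
  simp only [Qval, Rimm, Egamma]
  push_cast
  linarith

lemma linearGrowth_Vn [LinearOrder C] (cogStar : C) (C0 : ℝ)
    (hlam : 0 ≤ lam) (hγ0 : 0 ≤ γ) (hγ1 : γ ≤ 1)
    (hPnn : ∀ cog a τ cog', 0 ≤ P cog a τ cog') (hP0 : ∀ cog a cog', P cog a 0 cog' = 0)
    (hMom2 : ∀ cog a, Summable fun τ : ℕ => (τ : ℝ) ^ 2 * ∑' (cog' : C), P cog a τ cog')
    (n : ℕ) (cog : C) :
    LinearGrowth fun q => Vn cogStar c lam rH rN γ C0 Etau Etau2 P n q cog := by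
  induction n generalizing cog with
  | zero =>
    refine ⟨|C0|, fun q => ?_⟩
    simp only [Vn, abs_mul, abs_neg]
    exact mul_le_mul_of_nonneg_left (by linarith) (abs_nonneg C0)
  | succ n ih =>
    exact LinearGrowth.sup' _ fun a _ => linearGrowth_Qval hlam hγ0 hγ1 hPnn hP0 hMom2 ih cog a

end Bellman

/-- upper value-difference bound: if `E[τ|cog,a] ≤ t_max` and
`E[γ^τ|cog,a] ≤ ρ` for all admissible pairs, then for all `n`, `cog`, `q`, `Δ`:
`V_n(q,cog) − V_n(q+Δ,cog) ≤ (c·t_max·(1−ρⁿ)/(1−ρ) + C₀·ρⁿ)·Δ`. -/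
theorem stmt6 {C : Type*} [LinearOrder C] [Fintype C]
    (cogStar : C) (c lam rH rN γ : ℝ) (ts : ℕ)
    (Etau Etau2 : C → Action → ℝ) (P : C → Action → ℕ → C → ℝ)
    (hc : 0 < c) (hlam : 0 < lam) (hγ : γ ∈ Set.Ioo (0 : ℝ) 1)
    (hrN : 0 ≤ rN) (hrHN : rN < rH) (hts : 1 ≤ ts)
    (hPnn : ∀ cog a τ cog', 0 ≤ P cog a τ cog')
    (hP0 : ∀ cog a cog', P cog a 0 cog' = 0)
    (hPsum : ∀ cog, ∀ a ∈ Act cogStar cog, (∑' (τ : ℕ), ∑' (cog' : C), P cog a τ cog') = 1)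
    (hPS : ∀ cog τ cog', τ ≠ ts → P cog Action.S τ cog' = 0)
    (hEtau : ∀ cog a, Etau cog a = ∑' (τ : ℕ), ∑' (cog' : C), (τ : ℝ) * P cog a τ cog')
    (hEtau2 : ∀ cog a, Etau2 cog a = ∑' (τ : ℕ), ∑' (cog' : C), (τ : ℝ) ^ 2 * P cog a τ cog')
    (hMom2 : ∀ cog a, Summable fun τ : ℕ => (τ : ℝ) ^ 2 * ∑' (cog' : C), P cog a τ cog')
    (tmax : ℕ) (htmax : 1 ≤ tmax) (ρ : ℝ) (hρ : ρ ∈ Set.Ioo (0 : ℝ) 1)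
    (hEle : ∀ cog, ∀ a ∈ Act cogStar cog, Etau cog a ≤ (tmax : ℝ))
    (hEg : ∀ cog, ∀ a ∈ Act cogStar cog, Egamma γ P cog a ≤ ρ)
    (C0 : ℝ) (hC0 : 0 ≤ C0) :
    ∀ (n : ℕ) (cog : C) (q : ℤ) (Δ : ℕ),
      Vn cogStar c lam rH rN γ C0 Etau Etau2 P n q cog
          - Vn cogStar c lam rH rN γ C0 Etau Etau2 P n (q + (Δ : ℤ)) cog
        ≤ (c * (tmax : ℝ) * (1 - ρ ^ n) / (1 - ρ) + C0 * ρ ^ n) * (Δ : ℝ) := by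
  intro n
  induction n with
  | zero =>
    intro cog q Δ
    simp only [Vn]
    push_cast
    simp only [pow_zero, sub_self, mul_zero, zero_div, mul_one]
    linarith
  | succ n ih =>
    intro cog q Δ
    have hρ1 : 0 < 1 - ρ := by linarith [hρ.2]
    have hρn : 0 ≤ 1 - ρ ^ n := by linarith [pow_le_one₀ (n := n) hρ.1.le hρ.2.le]
    have hK : 0 ≤ (c * (tmax : ℝ) * (1 - ρ ^ n) / (1 - ρ) + C0 * ρ ^ n) * (Δ : ℝ) := by
      have := hρ.1
      positivity
    rw [Vn, Vn, sub_le_iff_le_add]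
    refine Finset.sup'_le _ _ fun a ha => ?_
    have h₁ := Qval_sub_le (c := c) (rH := rH) (rN := rN) (Etau := Etau) (Etau2 := Etau2)
      hlam.le hγ.1.le hγ.2.le hPnn hP0 hMom2
      (linearGrowth_Vn cogStar C0 hlam.le hγ.1.le hγ.2.le hPnn hP0 hMom2 n)
      (fun x q => ih x q Δ) cog a q
    have h₂ := Finset.le_sup' (fun a => Qval c lam rH rN γ Etau Etau2 P
      (Vn cogStar c lam rH rN γ C0 Etau Etau2 P n) (q + (Δ : ℤ)) cog a) ha
    have h₃ : c * Etau cog a * ((Δ : ℤ) : ℝ) ≤ c * tmax * Δ := by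
      rw [Int.cast_natCast]
      exact mul_le_mul_of_nonneg_right (mul_le_mul_of_nonneg_left (hEle cog a ha) hc.le)
        (Nat.cast_nonneg Δ)
    have h₄ := mul_le_mul_of_nonneg_right (hEg cog a ha) hK
    have h₅ : (c * (tmax : ℝ) * (1 - ρ ^ (n + 1)) / (1 - ρ) + C0 * ρ ^ (n + 1)) * (Δ : ℝ) =
        c * tmax * Δ + ρ * ((c * (tmax : ℝ) * (1 - ρ ^ n) / (1 - ρ) + C0 * ρ ^ n) * Δ) := by
      field_simp
      ring
    rw [h₅]
    linarith

end Fidelity
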